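/- arXiv:2302.06873 — 3 statements merged into one kernel-verified Lean document; each statement's English description precedes it below -/
import Mathlib

section
/- Let n be a natural number, e : Fin n → ℝ, and let i* be an index such that e i* ≤ e i for all i (the plan with the lowest one-dimensional embedding). Then for every index i, Σ_{j ≠ i} (1 − φ(e i − e j)) ≤ Σ_{j ≠ i*} (1 − φ(e i* − e j)). (This is the paper's Proposition: the plan P* = argmin_i PlanEmb(P_i) chosen with the lowest 1-dim embedding also maximizes the expected number of randomized wins E[RandomWins(·)] among all candidate plans.) -/
open Finset

/-- The logistic function `φ(x) = (1 + exp(−x))⁻¹`. -/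
noncomputable def phi (x : ℝ) : ℝ := (1 + Real.exp (-x))⁻¹

theorem phi_monotone : Monotone phi := by
  intro x y h
  unfold phi
  gcongr

/-- The plan with the lowest one-dimensional embedding maximizes the expected
number of randomized wins `E[RandomWins(·)] = Σ_{j ≠ i} (1 − φ(e i − e j))`. -/
theorem argmin_embedding_maximizes_random_wins (n : ℕ) (e : Fin n → ℝ)
    (istar : Fin n) (hstar : ∀ i, e istar ≤ e i) (i : Fin n) :
    ∑ j ∈ Finset.univ.erase i, (1 - phi (e i - e j)) ≤
      ∑ j ∈ Finset.univ.erase istar, (1 - phi (e istar - e j)) := by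
  simp only [Finset.sum_erase_eq_sub (Finset.mem_univ _), sub_self]
  gcongr with j
  exact phi_monotone (sub_le_sub_right (hstar i) (e j))
end

section
/- Let α > 1 and Δ ≥ 1 be real numbers, and let c, c* > 0 be positive reals with QE(c, c*) ≤ Δ. Then there exists an integer t with ⌊−log_α Δ⌋ ≤ t ≤ ⌈log_α Δ⌉ such that QE(α^t · c, c*) ≤ α. (For a cardinality estimate c whose q-error against the true cardinality c* is bounded by Δ, at least one scaling factor f = α^t in the set of guesses F_α^Δ brings the tuned estimate f·c within q-error α of the true value.) -/
/-- The q-error of an estimate `a` against a true value `b`: `QE(a, b) = max(a/b, b/a)`. -/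
noncomputable def QE (a b : ℝ) : ℝ := max (a / b) (b / a)

/-- If the cardinality estimate `c` has q-error at most `Δ` against the true
cardinality `c*`, then some scaling factor `α^t` with
`⌊−log_α Δ⌋ ≤ t ≤ ⌈log_α Δ⌉` brings the tuned estimate `α^t · c`
within q-error `α` of `c*`. -/
theorem exists_scaling_factor (α Δ c cstar : ℝ)
    (hα : 1 < α) (hΔ : 1 ≤ Δ) (hc : 0 < c) (hcstar : 0 < cstar)
    (hqe : QE c cstar ≤ Δ) :
    ∃ t : ℤ, ⌊-Real.logb α Δ⌋ ≤ t ∧ t ≤ ⌈Real.logb α Δ⌉ ∧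
      QE (α ^ t * c) cstar ≤ α := by
  have hα0 : 0 < α := by linarith
  obtain ⟨h₁, h₂⟩ := max_le_iff.mp hqe
  have hy : 0 < cstar / c := div_pos hcstar hc
  have hupper : Real.logb α (cstar / c) ≤ Real.logb α Δ :=
    Real.logb_le_logb_of_le hα hy h₂
  have hlower : -Real.logb α Δ ≤ Real.logb α (cstar / c) := by
    rw [neg_le, ← Real.logb_inv, inv_div]
    exact Real.logb_le_logb_of_le hα (div_pos hc hcstar) h₁
  refine ⟨⌊Real.logb α (cstar / c)⌋, Int.floor_mono hlower,
    (Int.floor_le_ceil _).trans (Int.ceil_mono hupper), ?_⟩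
  set t := ⌊Real.logb α (cstar / c)⌋
  have hle : α ^ t ≤ cstar / c := by
    rw [← Real.rpow_intCast, ← Real.le_logb_iff_rpow_le hα hy]
    exact Int.floor_le _
  have hlt : cstar / c < α ^ (t + 1) := by
    rw [← Real.rpow_intCast, ← Real.logb_lt_iff_lt_rpow hα hy]
    push_cast
    exact Int.lt_floor_add_one _
  have hpos : 0 < α ^ t := zpow_pos hα0 t
  rw [le_div_iff₀ hc] at hle
  rw [zpow_add_one₀ hα0.ne', div_lt_iff₀ hc] at hlt
  refine max_le ?_ ?_
  · exact ((div_le_one hcstar).mpr hle).trans hα.le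
  · rw [div_le_iff₀ (mul_pos hpos hc)]
    linarith
end

section
/- Let α > 1 and Δ ≥ 1 be real numbers, let S be a finite set (of sub-queries), and let c, c* : S → ℝ be functions with c(s) > 0, c*(s) > 0, and QE(c(s), c*(s)) ≤ Δ for every s ∈ S. Then there exists a function t : S → ℤ such that for every s ∈ S, ⌊−log_α Δ⌋ ≤ t(s) ≤ ⌈log_α Δ⌉ and QE(α^{t(s)} · c(s), c*(s)) ≤ α. (In the brute-force exploration strategy, at least one combination of scaling factors ⟨f_{Q'}⟩ yields a tuned estimator whose q-error is bounded by α simultaneously on all sub-queries.) -/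
/-- In the brute-force exploration strategy, at least one combination of scaling
factors `⟨α^{t(s)}⟩_{s ∈ S}` yields a tuned estimator whose q-error is bounded by
`α` simultaneously on all sub-queries `s ∈ S`. -/
theorem exists_scaling_factor_combination (α Δ : ℝ) (S : Type*) [Fintype S]
    (c cstar : S → ℝ) (hα : 1 < α) (hΔ : 1 ≤ Δ)
    (hc : ∀ s, 0 < c s) (hcstar : ∀ s, 0 < cstar s)
    (hqe : ∀ s, QE (c s) (cstar s) ≤ Δ) :
    ∃ t : S → ℤ, ∀ s,
      ⌊-Real.logb α Δ⌋ ≤ t s ∧ t s ≤ ⌈Real.logb α Δ⌉ ∧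
        QE (α ^ t s * c s) (cstar s) ≤ α := by
  have hα0 : 0 < α := one_pos.trans hα
  refine ⟨fun s => ⌊Real.logb α (cstar s / c s)⌋, fun s => ?_⟩
  have hcs := hc s
  have hcstars := hcstar s
  have hr : 0 < cstar s / c s := div_pos hcstars hcs
  obtain ⟨h₁, h₂⟩ := max_le_iff.mp (hqe s)
  refine ⟨Int.floor_mono ?_, (Int.floor_mono ?_).trans (Int.floor_le_ceil _), ?_⟩
  · rw [← Real.logb_inv]
    refine Real.logb_le_logb_of_le hα (by positivity) ?_
    rw [← inv_div (c s)]
    exact inv_anti₀ (div_pos hcs hcstars) h₁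
  · exact Real.logb_le_logb_of_le hα hr h₂
  · set n := ⌊Real.logb α (cstar s / c s)⌋ with hn
    have hlo : α ^ n ≤ cstar s / c s := by
      rw [← Real.rpow_intCast, ← Real.le_logb_iff_rpow_le hα hr]
      exact Int.floor_le _
    have hhi : cstar s / c s ≤ α ^ n * α := by
      rw [← zpow_add_one₀ hα0.ne', ← Real.rpow_intCast, ← Real.logb_le_iff_le_rpow hα hr]
      push_cast
      exact (Int.lt_floor_add_one _).le
    have hpow : 0 < α ^ n := zpow_pos hα0 n
    rw [le_div_iff₀ hcs] at hlo
    rw [div_le_iff₀ hcs] at hhi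
    refine max_le ?_ ?_
    · rw [div_le_iff₀ hcstars]
      nlinarith
    · rw [div_le_iff₀ (mul_pos hpow hcs)]
      linarith
end
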